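/- Let F be a Minkowski norm on a finite-dimensional real vector space E and let V ∈ E satisfy F(−V) > 1. Then the map φ(y) := y + F(y)·V is injective on the set A′ := { y ∈ E ∖ {0} : g_y(y,V) < −F(y) }. -/

import Mathlib

/-- The fundamental tensor of a (Minkowski-type) norm `F` at `y`:
`g_y(u,v) = (1/2) D²(F²)(y)(u,v)`. -/
noncomputable def fundTensor {E : Type*} [NormedAddCommGroup E] [NormedSpace ℝ E]
    (F : E → ℝ) (y u v : E) : ℝ :=
  (1 / 2) * iteratedFDeriv ℝ 2 (fun z => (F z) ^ 2) y ![u, v]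

/-- A Minkowski norm on a finite dimensional real vector space `E`. -/
structure IsMinkowskiNorm {E : Type*} [NormedAddCommGroup E] [NormedSpace ℝ E]
    (F : E → ℝ) : Prop where
  map_zero : F 0 = 0
  pos : ∀ y : E, y ≠ 0 → 0 < F y
  smooth : ContDiffOn ℝ (⊤ : ℕ∞) F {(0 : E)}ᶜ
  homog : ∀ t : ℝ, 0 < t → ∀ y : E, F (t • y) = t * F y
  symm : ∀ y : E, y ≠ 0 → ∀ u v : E, fundTensor F y u v = fundTensor F y v u
  posdef : ∀ y : E, y ≠ 0 → ∀ u : E, u ≠ 0 → 0 < fundTensor F y u u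

namespace IsMinkowskiNorm

variable {E : Type*} [NormedAddCommGroup E] [NormedSpace ℝ E] {F : E → ℝ}

lemma nonneg (hF : IsMinkowskiNorm F) (y : E) : 0 ≤ F y := by
  rcases eq_or_ne y 0 with rfl | hy
  · exact hF.map_zero.ge
  · exact (hF.pos y hy).le

lemma contDiffAt_sq (hF : IsMinkowskiNorm F) {y : E} (hy : y ≠ 0) :
    ContDiffAt ℝ (⊤ : ℕ∞) (fun z => F z ^ 2) y :=
  (hF.smooth.contDiffAt (isOpen_compl_singleton.mem_nhds hy)).pow 2

lemma hasFDerivAt_sq (hF : IsMinkowskiNorm F) {y : E} (hy : y ≠ 0) :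
    HasFDerivAt (fun z => F z ^ 2) (fderiv ℝ (fun z => F z ^ 2) y) y :=
  ((hF.contDiffAt_sq hy).differentiableAt (by simp)).hasFDerivAt

lemma hasFDerivAt_fderiv_sq (hF : IsMinkowskiNorm F) {y : E} (hy : y ≠ 0) :
    HasFDerivAt (fderiv ℝ (fun z => F z ^ 2))
      (fderiv ℝ (fderiv ℝ (fun z => F z ^ 2)) y) y :=
  (((hF.contDiffAt_sq hy).fderiv_right (m := 1)
    (by norm_cast)).differentiableAt (by simp)).hasFDerivAt

lemma fundTensor_eq (F : E → ℝ) (y u v : E) :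
    fundTensor F y u v = (1 / 2) * fderiv ℝ (fderiv ℝ (fun z => F z ^ 2)) y u v := by
  simp [fundTensor, iteratedFDeriv_two_apply]

lemma fderiv_sq_smul (hF : IsMinkowskiNorm F) {t : ℝ} (ht : 0 < t) (y : E) :
    fderiv ℝ (fun z => F z ^ 2) (t • y) = t • fderiv ℝ (fun z => F z ^ 2) y := by
  have h1 := fderiv_comp_smul (𝕜 := ℝ) (f := fun z => F z ^ 2) (x := y) t
  have h2 : (fun z => F (t • z) ^ 2) = t ^ 2 • fun z => F z ^ 2 := by
    funext z
    simp [hF.homog t ht, mul_pow]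
  rw [h2, fderiv_const_smul_field] at h1
  have h3 := congrArg (fun L => t⁻¹ • L) h1
  simpa [smul_smul, pow_two, ht.ne'] using h3.symm

/-- Euler's identity for the differential of `F²`. -/
lemma fderiv_fderiv_sq_self (hF : IsMinkowskiNorm F) {y : E} (hy : y ≠ 0) :
    fderiv ℝ (fderiv ℝ (fun z => F z ^ 2)) y y = fderiv ℝ (fun z => F z ^ 2) y := by
  have hline : HasDerivAt (fun t : ℝ => t • y) y 1 := by
    simpa using (hasDerivAt_id (1 : ℝ)).smul_const y
  have h1 := HasFDerivAt.comp_hasDerivAt_of_eq (1 : ℝ) (hF.hasFDerivAt_fderiv_sq hy) hline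
    (by simp)
  have h2 : HasDerivAt (fun t : ℝ => t • fderiv ℝ (fun z => F z ^ 2) y)
      (fderiv ℝ (fun z => F z ^ 2) y) 1 := by
    simpa using (hasDerivAt_id (1 : ℝ)).smul_const (fderiv ℝ (fun z => F z ^ 2) y)
  refine h1.unique (h2.congr_of_eventuallyEq ?_)
  filter_upwards [lt_mem_nhds (zero_lt_one' ℝ)] with t ht
  exact hF.fderiv_sq_smul ht y

/-- Euler's identity for `F²`. -/
lemma fderiv_sq_self (hF : IsMinkowskiNorm F) {y : E} (hy : y ≠ 0) :
    fderiv ℝ (fun z => F z ^ 2) y y = 2 * F y ^ 2 := by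
  have hline : HasDerivAt (fun t : ℝ => t • y) y 1 := by
    simpa using (hasDerivAt_id (1 : ℝ)).smul_const y
  have h1 := HasFDerivAt.comp_hasDerivAt_of_eq (1 : ℝ) (hF.hasFDerivAt_sq hy) hline (by simp)
  have h2 : HasDerivAt (fun t : ℝ => t ^ 2 * F y ^ 2) (2 * F y ^ 2) 1 := by
    simpa using (hasDerivAt_pow 2 (1 : ℝ)).mul_const (F y ^ 2)
  refine h1.unique (h2.congr_of_eventuallyEq ?_)
  filter_upwards [lt_mem_nhds (zero_lt_one' ℝ)] with t ht
  simp [hF.homog t ht, mul_pow]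

lemma fundTensor_self_left (hF : IsMinkowskiNorm F) {y : E} (hy : y ≠ 0) (v : E) :
    fundTensor F y y v = (1 / 2) * fderiv ℝ (fun z => F z ^ 2) y v := by
  rw [fundTensor_eq, hF.fderiv_fderiv_sq_self hy]

/-- The tangent-line inequality for `F²` along a segment avoiding the origin. -/
lemma sq_add_fderiv_sq_le (hF : IsMinkowskiNorm F) {y v : E}
    (hseg : ∀ t ∈ Set.Icc (0 : ℝ) 1, y + t • v ≠ 0) :
    F y ^ 2 + fderiv ℝ (fun z => F z ^ 2) y v ≤ F (y + v) ^ 2 := by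
  have hline (t : ℝ) : HasDerivAt (fun t : ℝ => y + t • v) v t := by
    simpa using ((hasDerivAt_id t).smul_const v).const_add y
  have hd1 : ∀ t ∈ Set.Icc (0 : ℝ) 1, HasDerivAt (fun t : ℝ => F (y + t • v) ^ 2)
      (fderiv ℝ (fun z => F z ^ 2) (y + t • v) v) t := fun t ht =>
    HasFDerivAt.comp_hasDerivAt (l := fun z => F z ^ 2) t
      (hF.hasFDerivAt_sq (hseg t ht)) (hline t)
  have hd2 : ∀ t ∈ Set.Icc (0 : ℝ) 1,
      HasDerivAt (fun t : ℝ => fderiv ℝ (fun z => F z ^ 2) (y + t • v) v)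
        (fderiv ℝ (fderiv ℝ (fun z => F z ^ 2)) (y + t • v) v v) t := fun t ht => by
    have h := HasFDerivAt.comp_hasDerivAt (l := fderiv ℝ fun z => F z ^ 2) t
      (hF.hasFDerivAt_fderiv_sq (hseg t ht)) (hline t)
    simpa using h.clm_apply (hasDerivAt_const t v)
  obtain ⟨c, hc, hc'⟩ := exists_hasDerivAt_eq_slope _ _ (zero_lt_one' ℝ)
    (fun t ht => (hd1 t ht).continuousAt.continuousWithinAt)
    (fun t ht => hd1 t (Set.Ioo_subset_Icc_self ht))
  have hsub : Set.Icc 0 c ⊆ Set.Icc (0 : ℝ) 1 := Set.Icc_subset_Icc_right hc.2.le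
  obtain ⟨d, hd, hd'⟩ := exists_hasDerivAt_eq_slope _ _ hc.1
    (fun t ht => (hd2 t (hsub ht)).continuousAt.continuousWithinAt)
    (fun t ht => hd2 t (hsub (Set.Ioo_subset_Icc_self ht)))
  have hpos : 0 ≤ fderiv ℝ (fderiv ℝ (fun z => F z ^ 2)) (y + d • v) v v := by
    rcases eq_or_ne v 0 with rfl | hv
    · simp
    · have := hF.posdef _ (hseg d (hsub (Set.Ioo_subset_Icc_self hd))) v hv
      rw [fundTensor_eq] at this
      linarith
  rw [hd', sub_zero, le_div_iff₀ hc.1] at hpos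
  simp only [one_smul, zero_smul, add_zero, sub_zero, div_one, zero_mul] at hc' hpos
  linarith

/-- The fundamental inequality `g_y(y, w) ≤ F(y) F(w)`. -/
lemma fundTensor_self_left_le (hF : IsMinkowskiNorm F) {y : E} (hy : y ≠ 0) (w : E) :
    fundTensor F y y w ≤ F y * F w := by
  rw [hF.fundTensor_self_left hy]
  have hFy := hF.pos y hy
  by_cases hray : ∃ c : ℝ, 0 ≤ c ∧ w = -c • y
  · obtain ⟨c, hc, hw⟩ := hray
    have h1 : fderiv ℝ (fun z => F z ^ 2) y w = -c * (2 * F y ^ 2) := by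
      rw [hw, map_smul, hF.fderiv_sq_self hy, smul_eq_mul]
    rw [h1]
    have h2 := mul_nonneg hFy.le (hF.nonneg w)
    have h3 := mul_nonneg hc (sq_nonneg (F y))
    linarith
  · have hw : w ≠ 0 := fun h => hray ⟨0, le_rfl, by simp [h]⟩
    have hFw := hF.pos w hw
    set m := F y / F w with hm
    have hm0 : 0 < m := div_pos hFy hFw
    have hmw : m * F w = F y := div_mul_cancel₀ _ hFw.ne'
    have hseg : ∀ t ∈ Set.Icc (0 : ℝ) 1, y + t • (m • w - y) ≠ 0 := by
      intro t ht h
      have h' : (t * m) • w = -(1 - t) • y := by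
        rw [← sub_eq_zero, ← h]
        module
      rcases ht.1.eq_or_lt with rfl | ht0
      · simp at h
        exact hy h
      · have htm : 0 < t * m := mul_pos ht0 hm0
        refine hray ⟨(t * m)⁻¹ * (1 - t), mul_nonneg (inv_nonneg.2 htm.le)
          (sub_nonneg.2 ht.2), ?_⟩
        rw [← mul_neg, mul_smul, ← h', inv_smul_smul₀ htm.ne']
    have h := hF.sq_add_fderiv_sq_le hseg
    rw [add_sub_cancel, hF.homog m hm0, hmw, map_sub, map_smul, hF.fderiv_sq_self hy,
      smul_eq_mul] at h
    have h2 : m * fderiv ℝ (fun z => F z ^ 2) y w ≤ m * (2 * (F y * F w)) := by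
      calc _ ≤ 2 * F y ^ 2 := by linarith
        _ = 2 * F y * (m * F w) := by rw [hmw]; ring
        _ = _ := by ring
    have := le_of_mul_le_mul_left h2 hm0
    linarith

lemma nonneg_of_map_add_smul_eq (hF : IsMinkowskiNorm F) {y V : E} (hy : y ≠ 0)
    (hV : fundTensor F y y V < -F y) {t : ℝ} (ht : F (y + t • V) = F y - t) : 0 ≤ t := by
  have h := hF.fundTensor_self_left_le hy (y + t • V)
  rw [hF.fundTensor_self_left hy] at h hV
  rw [map_add, map_smul, hF.fderiv_sq_self hy, ht, smul_eq_mul] at h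
  by_contra! hneg
  nlinarith

end IsMinkowskiNorm

/-- the navigation map `φ(y) = y + F(y)·V` is injective on
`A' = {y ≠ 0 : g_y(y,V) < -F(y)}`. -/
theorem lorentz_navigation_map_injOn
    {E : Type*} [NormedAddCommGroup E] [NormedSpace ℝ E] [FiniteDimensional ℝ E]
    (F : E → ℝ) (hF : IsMinkowskiNorm F) (V : E) (hV : 1 < F (-V)) :
    Set.InjOn (fun y : E => y + F y • V)
      {y : E | y ≠ 0 ∧ fundTensor F y y V < -(F y)} := by
  rintro y ⟨hy, hyV⟩ z ⟨hz, hzV⟩ h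
  have h : y + F y • V = z + F z • V := h
  have hzy : y + (F y - F z) • V = z := by
    rw [sub_smul, ← add_sub_assoc, h, add_sub_cancel_right]
  have hyz : z + (F z - F y) • V = y := by
    rw [sub_smul, ← add_sub_assoc, ← h, add_sub_cancel_right]
  have h1 := hF.nonneg_of_map_add_smul_eq hy hyV (by rw [hzy]; ring)
  have h2 := hF.nonneg_of_map_add_smul_eq hz hzV (by rw [hyz]; ring)
  have h3 : F y = F z := by linarith
  simpa [h3] using h
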